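/- The S₂-invariants in Q^{U_n} form the subalgebra ℂ[α, γ²], and the sign-isotypic part of Q^{U_n} is (Q^{U_n})^{sgn} = γ·ℂ[α, γ²]; that is, (Q^{U_n})^{S₂} = ℂ[α, γ²] and (Q^{U_n})^{sgn} = γ·ℂ[α, γ²]. -/

import Mathlib

open MvPolynomial

noncomputable section

/-- The polynomial ring `𝒫 = ℂ[x_{ij} : 1 ≤ i ≤ n, 1 ≤ j ≤ 2]` in the entries of an
`n × 2` matrix of indeterminates. -/
abbrev P (n : ℕ) : Type := MvPolynomial (Fin n × Fin 2) ℂ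

/-- The action of a matrix `g` on `𝒫`, given by `(g · f)(X) = f(gᵀ X)`;
on variables it sends `x_{ij} ↦ ∑ s g_{si} x_{sj}`. -/
def matAct (n : ℕ) (g : Matrix (Fin n) (Fin n) ℂ) : P n →ₐ[ℂ] P n :=
  aeval fun p : Fin n × Fin 2 => ∑ s : Fin n, C (g s p.1) * X (s, p.2)

/-- The action of `σ ∈ S₂` permuting columns: `x_{ij} ↦ x_{iσ(j)}`. -/
def permAct (n : ℕ) (σ : Equiv.Perm (Fin 2)) : P n →ₐ[ℂ] P n :=
  aeval fun p : Fin n × Fin 2 => X (p.1, σ p.2)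

/-- `g` is upper triangular with all diagonal entries equal to `1`, i.e. `g ∈ U_n`. -/
def IsUpperUni (n : ℕ) (g : Matrix (Fin n) (Fin n) ℂ) : Prop :=
  (∀ i, g i i = 1) ∧ ∀ i j, j < i → g i j = 0

/-- `f` is `U_n`-invariant. -/
def UInv (n : ℕ) (f : P n) : Prop :=
  ∀ g : Matrix (Fin n) (Fin n) ℂ, IsUpperUni n g → matAct n g f = f

/-- `f ∈ Q_m` : each monomial of `f` has total degree `m` in the column-`j` variables,
for each `j`. -/
def InQm (n m : ℕ) (f : P n) : Prop :=
  ∀ d ∈ f.support, ∀ j : Fin 2, (∑ i : Fin n, d (i, j)) = m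

/-- `f ∈ Q = ⊕ₘ Q_m` : each monomial of `f` has equal total degree in the two columns. -/
def InQ (n : ℕ) (f : P n) : Prop :=
  ∀ d ∈ f.support, ∀ j : Fin 2, (∑ i : Fin n, d (i, j)) = ∑ i : Fin n, d (i, (0 : Fin 2))

/-- The variable `x_{(i+1)(j+1)}`, `i j : Fin 2` (0-indexed rows and columns). -/
def Xe (n : ℕ) (hn : 2 ≤ n) (i j : Fin 2) : P n := X (Fin.castLE hn i, j)

/-- `α = x₁₁ x₁₂`. -/
def alpha (n : ℕ) (hn : 2 ≤ n) : P n := Xe n hn 0 0 * Xe n hn 0 1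

/-- `γ = x₁₁ x₂₂ − x₂₁ x₁₂`. -/
def gamma (n : ℕ) (hn : 2 ≤ n) : P n := Xe n hn 0 0 * Xe n hn 1 1 - Xe n hn 1 0 * Xe n hn 0 1

theorem inQ_iff_isWeightedHomogeneous {n : ℕ} {f : P n} :
    InQ n f ↔ IsWeightedHomogeneous
      (fun p : Fin n × Fin 2 => if p.2 = 0 then (1 : ℤ) else -1) f 0 := by
  have key (d : Fin n × Fin 2 →₀ ℕ) :
      Finsupp.weight (fun p : Fin n × Fin 2 => if p.2 = 0 then (1 : ℤ) else -1) d =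
        (∑ i, d (i, 0) : ℕ) - (∑ i, d (i, 1) : ℕ) := by
    rw [Finsupp.weight_apply, Finsupp.sum_fintype _ _ (by simp), Fintype.sum_prod_type_right]
    simp [Fin.sum_univ_two, sub_eq_add_neg]
  unfold InQ IsWeightedHomogeneous
  refine forall_congr' fun d => ?_
  rw [mem_support_iff, key, Fin.forall_fin_two]
  refine imp_congr_right fun _ => ?_
  omega

theorem InQ.eval_column_rescale {n : ℕ} {f : P n} (hf : InQ n f) {c : ℂ} (hc : c ≠ 0)
    (M : Fin n × Fin 2 → ℂ) :
    eval (fun p => (if p.2 = 0 then c⁻¹ else c) * M p) f = eval M f := by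
  rw [eval_eq', eval_eq']
  refine Finset.sum_congr rfl fun d hd => ?_
  congr 1
  have h : ∏ p : Fin n × Fin 2, (if p.2 = 0 then c⁻¹ else c) ^ d p = 1 := by
    rw [Fintype.prod_prod_type_right, Fin.prod_univ_two]
    simp only [one_ne_zero, if_true, if_false, Finset.prod_pow_eq_pow_sum, hf d hd 1]
    rw [← mul_pow, inv_mul_cancel₀ hc, one_pow]
  simp only [mul_pow, Finset.prod_mul_distrib, h, one_mul]

theorem eval_aeval_eq {σ τ R : Type*} [CommSemiring R] (M : τ → R) (φ : σ → MvPolynomial τ R)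
    (f : MvPolynomial σ R) : eval M (aeval φ f) = eval (fun p => eval M (φ p)) f := by
  have h : (eval M).comp (algebraMap R (MvPolynomial τ R)) = RingHom.id R := by
    ext; simp [MvPolynomial.algebraMap_eq]
  rw [aeval_def, eval_eval₂, h, eval₂_id]

theorem eval_matAct {n : ℕ} (g : Matrix (Fin n) (Fin n) ℂ) (M : Fin n × Fin 2 → ℂ) (f : P n) :
    eval M (matAct n g f) = eval (fun p => ∑ s, g s p.1 * M (s, p.2)) f := by
  rw [matAct, eval_aeval_eq]
  simp

/-- A matrix in `U_n` acts by adding multiples of the first two rows to the rows below them. -/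
theorem UInv.eval_row_add {n : ℕ} {f : P n} (hf : UInv n f) {z o : Fin n}
    (hz : ∀ i, i ≠ z → z < i) (ho : ∀ i, i ≠ z → i ≠ o → o < i) {A B : Fin n → ℂ}
    (hA : A z = 0) (hBz : B z = 0) (hBo : B o = 0) (M : Fin n × Fin 2 → ℂ) :
    eval (fun p => M p + A p.1 * M (z, p.2) + B p.1 * M (o, p.2)) f = eval M f := by
  let g : Matrix (Fin n) (Fin n) ℂ := fun s i =>
    (if s = i then 1 else 0) + (if s = z then A i else 0) + (if s = o then B i else 0)
  have hg : IsUpperUni n g := by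
    constructor
    · intro i
      simp only [g]
      split_ifs <;> simp_all
    · intro i j hij
      have hi : i ≠ j := hij.ne'
      have hiz : i = z → A j = 0 := by
        rintro rfl
        by_contra h
        exact absurd (hz j fun e => h (e ▸ hA)) hij.asymm
      have hio : i = o → B j = 0 := by
        rintro rfl
        by_contra h
        exact absurd (ho j (fun e => h (e ▸ hBz)) (fun e => h (e ▸ hBo))) hij.asymm
      simp only [g, hi, if_false]
      split_ifs <;> simp_all
  conv_rhs => rw [← hf g hg, eval_matAct]
  simp [g, add_mul, Finset.sum_add_distrib]

theorem gamma_ne_zero (n : ℕ) (hn : 2 ≤ n) : gamma n hn ≠ 0 := by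
  intro h
  have := congrArg (eval fun p : Fin n × Fin 2 => if p.1.val = p.2.val then (1 : ℂ) else 0) h
  simp [gamma, Xe] at this

/-- The substitution bringing a matrix to the normal form with first two rows `(1, α)`, `(0, γ)`
and all other rows zero. -/
def normalForm (n : ℕ) (hn : 2 ≤ n) (p : Fin n × Fin 2) : P n :=
  if p.1 = Fin.castLE hn 0 then (if p.2 = 0 then 1 else alpha n hn)
  else if p.1 = Fin.castLE hn 1 then (if p.2 = 0 then 0 else gamma n hn)
  else 0

theorem eval_aeval_normalForm {n : ℕ} (hn : 2 ≤ n) {f : P n} (hQ : InQ n f) (hU : UInv n f)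
    {M : Fin n × Fin 2 → ℂ} (ha : M (Fin.castLE hn 0, 0) ≠ 0) (hγ : eval M (gamma n hn) ≠ 0) :
    eval M (aeval (normalForm n hn) f) = eval M f := by
  have hz : ∀ i, i ≠ Fin.castLE hn 0 → Fin.castLE hn 0 < i := by
    intro i hi
    simp only [ne_eq, Fin.ext_iff, Fin.lt_def, Fin.val_castLE, Fin.val_zero] at *
    omega
  have ho : ∀ i, i ≠ Fin.castLE hn 0 → i ≠ Fin.castLE hn 1 → Fin.castLE hn 1 < i := by
    intro i hi hi'
    simp only [ne_eq, Fin.ext_iff, Fin.lt_def, Fin.val_castLE, Fin.val_zero, Fin.val_one] at *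
    omega
  have hα' : eval M (alpha n hn) = M (Fin.castLE hn 0, 0) * M (Fin.castLE hn 0, 1) := by
    simp [alpha, Xe]
  have hγ' : eval M (gamma n hn) = M (Fin.castLE hn 0, 0) * M (Fin.castLE hn 1, 1) -
      M (Fin.castLE hn 1, 0) * M (Fin.castLE hn 0, 1) := by
    simp [gamma, Xe]
  rw [hγ'] at hγ
  have hnf (i : Fin n) (j : Fin 2) : normalForm n hn (i, j) =
      if i = Fin.castLE hn 0 then (if j = 0 then 1 else alpha n hn)
      else if i = Fin.castLE hn 1 then (if j = 0 then 0 else gamma n hn) else 0 := rfl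
  generalize Fin.castLE hn 0 = z at *
  generalize Fin.castLE hn 1 = o at *
  let A : Fin n → ℂ := fun i => if i = z then 0 else if i = o then -M (o, 0) / M (z, 0) else
    (M (o, 0) * M (i, 1) - M (i, 0) * M (o, 1)) / (M (z, 0) * M (o, 1) - M (o, 0) * M (z, 1))
  let B : Fin n → ℂ := fun i => if i = z then 0 else if i = o then 0 else
    (M (i, 0) * M (z, 1) - M (z, 0) * M (i, 1)) / (M (z, 0) * M (o, 1) - M (o, 0) * M (z, 1))
  rw [eval_aeval_eq]
  refine Eq.trans ?_ ((hQ.eval_column_rescale ha _).trans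
    (hU.eval_row_add hz ho (A := A) (B := B) (by simp [A]) (by simp [B]) (by simp [B]) M))
  congr 2
  funext ⟨i, j⟩
  by_cases hiz : i = z
  · subst hiz
    fin_cases j <;> simp [hnf, A, B, hα', ha]
  by_cases hio : i = o
  · subst hio
    fin_cases j <;> simp [hnf, A, B, hγ', hiz, ha]
    field_simp
    ring
  fin_cases j <;> simp [hnf, A, B, hiz, hio, ha]
  · linear_combination (-M (i, 0)) * mul_inv_cancel₀ hγ
  · linear_combination (-M (i, 1)) * mul_inv_cancel₀ hγ

theorem aeval_normalForm_eq {n : ℕ} (hn : 2 ≤ n) {f : P n} (hQ : InQ n f) (hU : UInv n f) :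
    aeval (normalForm n hn) f = f := by
  have h : (aeval (normalForm n hn) f - f) * (X (Fin.castLE hn 0, 0) * gamma n hn) = 0 := by
    refine MvPolynomial.funext fun M => ?_
    simp only [map_mul, map_sub, map_zero, eval_X]
    by_cases ha : M (Fin.castLE hn 0, 0) = 0
    · simp [ha]
    by_cases hγ : eval M (gamma n hn) = 0
    · simp [hγ]
    rw [eval_aeval_normalForm hn hQ hU ha hγ, sub_self, zero_mul]
  exact sub_eq_zero.1 ((mul_eq_zero.1 h).resolve_right
    (mul_ne_zero (X_ne_zero _) (gamma_ne_zero n hn)))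

theorem exists_eq_add_gamma_mul {n : ℕ} (hn : 2 ≤ n) {f : P n} (hQ : InQ n f) (hU : UInv n f) :
    ∃ p ∈ Algebra.adjoin ℂ {alpha n hn, gamma n hn ^ 2},
      ∃ q ∈ Algebra.adjoin ℂ {alpha n hn, gamma n hn ^ 2}, f = p + gamma n hn * q := by
  set S := Algebra.adjoin ℂ {alpha n hn, gamma n hn ^ 2}
  have hα : alpha n hn ∈ S := Algebra.subset_adjoin (by simp)
  have hγ : gamma n hn ^ 2 ∈ S := Algebra.subset_adjoin (by simp)
  rw [← aeval_normalForm_eq hn hQ hU]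
  clear hQ hU
  induction f using MvPolynomial.induction_on with
  | C a => exact ⟨algebraMap ℂ _ a, S.algebraMap_mem a, 0, S.zero_mem, by simp⟩
  | add f g hf hg =>
    obtain ⟨p, hp, q, hq, h⟩ := hf
    obtain ⟨p', hp', q', hq', h'⟩ := hg
    refine ⟨p + p', S.add_mem hp hp', q + q', S.add_mem hq hq', ?_⟩
    rw [map_add, h, h']
    ring
  | mul_X f i hf =>
    obtain ⟨p, hp, q, hq, h⟩ := hf
    rw [map_mul, h, aeval_X, normalForm]
    split_ifs
    · exact ⟨p, hp, q, hq, by ring⟩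
    · exact ⟨p * alpha n hn, S.mul_mem hp hα, q * alpha n hn, S.mul_mem hq hα, by ring⟩
    · exact ⟨0, S.zero_mem, 0, S.zero_mem, by ring⟩
    · exact ⟨gamma n hn ^ 2 * q, S.mul_mem hγ hq, p, hp, by ring⟩
    · exact ⟨0, S.zero_mem, 0, S.zero_mem, by ring⟩

theorem permAct_swap_alpha (n : ℕ) (hn : 2 ≤ n) :
    permAct n (Equiv.swap 0 1) (alpha n hn) = alpha n hn := by
  simp [permAct, alpha, Xe, mul_comm]

theorem permAct_swap_gamma (n : ℕ) (hn : 2 ≤ n) :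
    permAct n (Equiv.swap 0 1) (gamma n hn) = -gamma n hn := by
  simp [permAct, gamma, Xe]
  ring

theorem inQ_alpha (n : ℕ) (hn : 2 ≤ n) : InQ n (alpha n hn) := by
  rw [inQ_iff_isWeightedHomogeneous]
  exact (isWeightedHomogeneous_X _ _ _).mul (isWeightedHomogeneous_X _ _ _)

theorem inQ_gamma (n : ℕ) (hn : 2 ≤ n) : InQ n (gamma n hn) := by
  rw [inQ_iff_isWeightedHomogeneous]
  exact ((isWeightedHomogeneous_X _ _ _).mul (isWeightedHomogeneous_X _ _ _)).sub
    ((isWeightedHomogeneous_X _ _ _).mul (isWeightedHomogeneous_X _ _ _))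

theorem InQ.mul {n : ℕ} {f g : P n} (hf : InQ n f) (hg : InQ n g) : InQ n (f * g) := by
  rw [inQ_iff_isWeightedHomogeneous] at *
  simpa using IsWeightedHomogeneous.mul hf hg

theorem UInv.mul {n : ℕ} {f g : P n} (hf : UInv n f) (hg : UInv n g) : UInv n (f * g) :=
  fun u hu => by rw [map_mul, hf u hu, hg u hu]

theorem matAct_Xe_zero {n : ℕ} (hn : 2 ≤ n) {g : Matrix (Fin n) (Fin n) ℂ}
    (hg : IsUpperUni n g) (j : Fin 2) : matAct n g (Xe n hn 0 j) = Xe n hn 0 j := by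
  simp only [matAct, Xe, aeval_X]
  rw [Finset.sum_eq_single (Fin.castLE hn 0) _ (by simp)]
  · simp [hg.1]
  · intro s _ hs
    rw [hg.2, C_0, zero_mul]
    simp only [ne_eq, Fin.ext_iff, Fin.lt_def, Fin.val_castLE, Fin.val_zero] at *
    omega

theorem matAct_Xe_one {n : ℕ} (hn : 2 ≤ n) {g : Matrix (Fin n) (Fin n) ℂ}
    (hg : IsUpperUni n g) (j : Fin 2) : matAct n g (Xe n hn 1 j) =
      C (g (Fin.castLE hn 0) (Fin.castLE hn 1)) * Xe n hn 0 j + Xe n hn 1 j := by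
  simp only [matAct, Xe, aeval_X]
  rw [Fintype.sum_eq_add (Fin.castLE hn 0) (Fin.castLE hn 1) (by simp [Fin.ext_iff])]
  · simp [hg.1]
  · rintro s ⟨hs, hs'⟩
    rw [hg.2, C_0, zero_mul]
    simp only [ne_eq, Fin.ext_iff, Fin.lt_def, Fin.val_castLE, Fin.val_zero, Fin.val_one] at *
    omega

theorem uInv_alpha (n : ℕ) (hn : 2 ≤ n) : UInv n (alpha n hn) := fun g hg => by
  simp [alpha, matAct_Xe_zero hn hg]

theorem uInv_gamma (n : ℕ) (hn : 2 ≤ n) : UInv n (gamma n hn) := fun g hg => by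
  simp only [gamma, map_sub, map_mul, matAct_Xe_zero hn hg, matAct_Xe_one hn hg]
  ring

theorem inQ_uInv_permAct_of_mem_adjoin {n : ℕ} (hn : 2 ≤ n) {f : P n}
    (hf : f ∈ Algebra.adjoin ℂ {alpha n hn, gamma n hn ^ 2}) :
    InQ n f ∧ UInv n f ∧ permAct n (Equiv.swap 0 1) f = f := by
  induction hf using Algebra.adjoin_induction with
  | mem x hx =>
    obtain rfl | rfl := hx
    · exact ⟨inQ_alpha n hn, uInv_alpha n hn, permAct_swap_alpha n hn⟩
    · rw [pow_two]
      refine ⟨(inQ_gamma n hn).mul (inQ_gamma n hn), (uInv_gamma n hn).mul (uInv_gamma n hn), ?_⟩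
      rw [map_mul, permAct_swap_gamma, neg_mul_neg]
  | algebraMap r =>
    refine ⟨?_, fun g _ => AlgHom.commutes _ r, AlgHom.commutes _ r⟩
    rw [inQ_iff_isWeightedHomogeneous]
    exact isWeightedHomogeneous_C _ r
  | add f g _ _ hf hg =>
    refine ⟨?_, fun u hu => by rw [map_add, hf.2.1 u hu, hg.2.1 u hu],
      by rw [map_add, hf.2.2, hg.2.2]⟩
    have h := hf.1
    have h' := hg.1
    rw [inQ_iff_isWeightedHomogeneous] at *
    exact h.add h'
  | mul f g _ _ hf hg =>
    exact ⟨hf.1.mul hg.1, hf.2.1.mul hg.2.1, by rw [map_mul, hf.2.2, hg.2.2]⟩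

/-- `(Q^{U_n})^{S₂} = ℂ[α, γ²]` and `(Q^{U_n})^{sgn} = γ · ℂ[α, γ²]`. -/
theorem stmt_5 (n : ℕ) (hn : 2 ≤ n) :
    ({f : P n | InQ n f ∧ UInv n f ∧ permAct n (Equiv.swap 0 1) f = f} =
      (Algebra.adjoin ℂ {alpha n hn, gamma n hn ^ 2} : Set (P n))) ∧
    ({f : P n | InQ n f ∧ UInv n f ∧ permAct n (Equiv.swap 0 1) f = -f} =
      (fun h => gamma n hn * h) '' (Algebra.adjoin ℂ {alpha n hn, gamma n hn ^ 2} : Set (P n))) := by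
  constructor
  · ext f
    refine ⟨?_, inQ_uInv_permAct_of_mem_adjoin hn⟩
    rintro ⟨hQ, hU, hf⟩
    obtain ⟨p, hp, q, hq, rfl⟩ := exists_eq_add_gamma_mul hn hQ hU
    rw [map_add, map_mul, permAct_swap_gamma, (inQ_uInv_permAct_of_mem_adjoin hn hp).2.2,
      (inQ_uInv_permAct_of_mem_adjoin hn hq).2.2] at hf
    have h : gamma n hn * q = 0 := self_eq_neg.1 (by linear_combination -hf)
    rwa [h, add_zero]
  · ext f
    constructor
    · rintro ⟨hQ, hU, hf⟩
      obtain ⟨p, hp, q, hq, rfl⟩ := exists_eq_add_gamma_mul hn hQ hU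
      rw [map_add, map_mul, permAct_swap_gamma, (inQ_uInv_permAct_of_mem_adjoin hn hp).2.2,
        (inQ_uInv_permAct_of_mem_adjoin hn hq).2.2] at hf
      have h : p = 0 := self_eq_neg.1 (by linear_combination hf)
      exact ⟨q, hq, by simp [h]⟩
    · rintro ⟨q, hq, rfl⟩
      obtain ⟨hQ, hU, hτ⟩ := inQ_uInv_permAct_of_mem_adjoin hn hq
      refine ⟨(inQ_gamma n hn).mul hQ, (uInv_gamma n hn).mul hU, ?_⟩
      rw [map_mul, permAct_swap_gamma, hτ, neg_mul]
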